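/- arXiv:1909.10935 — 2 statements merged into one kernel-verified Lean document; each statement's English description precedes it below -/
import Mathlib

section
/- Let n ≥ 1, let d ≥ 2 be even, and let p ≥ 1. For every f ∈ F_{d,n} with ‖f‖_{L^p(S^{n−1})} ≤ 1 one has v(f) ≥ (2π^{n/2}/Γ(n/2))^{n/(dp)} · π^{n/2}/Γ(n/2+1), and equality holds if and only if f = b_{d,n}/‖b_{d,n}‖_{L^p(S^{n−1})}, where ‖b_{d,n}‖_{L^p(S^{n−1})} = (2π^{n/2}/Γ(n/2))^{1/p}. -/
open MvPolynomial MeasureTheory Real Finset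

/-- `v(f)`: the Lebesgue volume of the sublevel set `{x ∈ ℝⁿ : f(x) ≤ 1}`. -/
noncomputable def sublevelVol (n : ℕ) (f : MvPolynomial (Fin n) ℝ) : ENNReal :=
  volume {x : Fin n → ℝ | eval x f ≤ 1}

/-- `b_{d,n}(x) = (x₁² + ⋯ + x_n²)^{d/2}`. -/
noncomputable def ballForm (n d : ℕ) : MvPolynomial (Fin n) ℝ :=
  (∑ i : Fin n, X i ^ 2) ^ (d / 2)

/-- `π^{n/2} / Γ(n/2 + 1)`, the volume of the unit Euclidean ball in `ℝⁿ`. -/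
noncomputable def unitBallVol (n : ℕ) : ℝ :=
  π ^ ((n : ℝ) / 2) / Real.Gamma ((n : ℝ) / 2 + 1)

/-- The `L^p`-norm of a form on the unit sphere `S^{n-1}`, with respect to the
surface (Riemannian volume) measure on the sphere. -/
noncomputable def sphereLpNorm (n : ℕ) (p : ℝ) (f : MvPolynomial (Fin n) ℝ) : ℝ :=
  (∫ x : Metric.sphere (0 : EuclideanSpace ℝ (Fin n)) 1,
      |eval (fun i => (x : EuclideanSpace ℝ (Fin n)) i) f| ^ p
      ∂((volume : Measure (EuclideanSpace ℝ (Fin n))).toSphere)) ^ (1 / p)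

/-- A measurable set is measured by integrating the measures of its rays over the unit sphere. -/
theorem measure_eq_lintegral_toSphere {E : Type*} [NormedAddCommGroup E] [NormedSpace ℝ E]
    [MeasurableSpace E] [BorelSpace E] [FiniteDimensional ℝ E] [Nontrivial E]
    (μ : Measure E) [μ.IsAddHaarMeasure] {s : Set E} (hs : MeasurableSet s) :
    μ s = ∫⁻ θ, Measure.volumeIoiPow (Module.finrank ℝ E - 1)
      {r | r.1 • (θ : E) ∈ s} ∂μ.toSphere := by
  have h0 : MeasurableSet ({0}ᶜ : Set E) := (measurableSet_singleton _).compl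
  have hmp := μ.measurePreserving_homeomorphUnitSphereProd
  have hT : MeasurableSet {q : Metric.sphere (0 : E) 1 × Set.Ioi (0 : ℝ) | q.2.1 • (q.1 : E) ∈ s} :=
    (by fun_prop : Measurable
      fun q : Metric.sphere (0 : E) 1 × Set.Ioi (0 : ℝ) => q.2.1 • (q.1 : E)) hs
  have h1 : μ s = μ (s ∩ {0}ᶜ) := by
    rw [← Set.sdiff_eq, measure_sdiff_null (measure_singleton _)]
  have h2 : μ (s ∩ {0}ᶜ) = μ.comap ((↑) : ({0}ᶜ : Set E) → E) ((↑) ⁻¹' s) := by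
    rw [comap_subtype_coe_apply h0, Subtype.image_preimage_coe, Set.inter_comm]
  have h3 : ((↑) ⁻¹' s : Set ({0}ᶜ : Set E)) =
      homeomorphUnitSphereProd E ⁻¹' {q | q.2.1 • (q.1 : E) ∈ s} := by
    ext x
    have hx : ‖(x : E)‖ ≠ 0 := norm_ne_zero_iff.2 x.2
    simp [smul_smul, hx]
  rw [h1, h2, h3, hmp.measure_preimage hT.nullMeasurableSet, Measure.prod_apply hT]
  rfl

theorem ofReal_integral_le_lintegral_ofReal {α : Type*} [MeasurableSpace α] {μ : Measure α}
    {f : α → ℝ} (hf : Integrable f μ) :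
    ENNReal.ofReal (∫ x, f x ∂μ) ≤ ∫⁻ x, ENNReal.ofReal (f x) ∂μ := by
  have h : ∫⁻ x, ENNReal.ofReal (f x) ∂μ = ∫⁻ x, ENNReal.ofReal (max (f x) 0) ∂μ := by
    simp [ENNReal.ofReal_max]
  rw [h, ← ofReal_integral_eq_lintegral_ofReal hf.pos_part (.of_forall fun x => le_max_right _ _)]
  exact ENNReal.ofReal_le_ofReal
    (integral_mono hf hf.pos_part fun x => le_max_left _ _)

/-- Bernoulli's inequality for negative exponents, strict away from `1`. -/
theorem one_sub_mul_lt_rpow_neg {s u : ℝ} (hs : 0 < s) (hu : 0 < u) (hu1 : u ≠ 1) :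
    1 - s * (u - 1) < u ^ (-s) := by
  have h1 := Real.log_lt_sub_one_of_pos hu hu1
  have h2 := Real.add_one_le_exp (Real.log u * -s)
  rw [Real.rpow_def_of_pos hu]
  nlinarith

/-- The affine minorant of `c ↦ c ^ (-(k / d)) / k`, in the variable `c ^ p`, at the point
`c = m ^ (-(1 / p))`. -/
noncomputable def radialMinorant (k d : ℕ) (p m c : ℝ) : ℝ :=
  m ^ ((k : ℝ) / (d * p)) / k * (1 - (k : ℝ) / (d * p) * (m * |c| ^ p - 1))

theorem pow_div_eq_rpow {k d : ℕ} (hk : k ≠ 0) (hd : d ≠ 0) {p m c : ℝ} (hp : 0 < p) (hm : 0 < m)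
    (hc : 0 < c) :
    (c ^ (-(1 / (d : ℝ)))) ^ k / k
      = m ^ ((k : ℝ) / (d * p)) / k * (m * |c| ^ p) ^ (-((k : ℝ) / (d * p))) := by
  rw [abs_of_pos hc, Real.mul_rpow hm.le (by positivity), ← Real.rpow_mul hc.le,
    ← Real.rpow_natCast, ← Real.rpow_mul hc.le, Real.rpow_neg hm.le]
  have : m ^ ((k : ℝ) / (d * p)) ≠ 0 := by positivity
  have h : p * -((k : ℝ) / (d * p)) = -(1 / (d : ℝ)) * k := by
    field_simp
  rw [h]
  field_simp

theorem radialMinorant_lt {k d : ℕ} (hk : k ≠ 0) (hd : d ≠ 0) {p m c : ℝ} (hp : 0 < p) (hm : 0 < m)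
    (hc : 0 < c) (hc' : m * |c| ^ p ≠ 1) :
    radialMinorant k d p m c < (c ^ (-(1 / (d : ℝ)))) ^ k / k := by
  rw [pow_div_eq_rpow hk hd hp hm hc, radialMinorant]
  have : 0 < m * |c| ^ p := by have := abs_pos.2 hc.ne'; positivity
  have : 0 < m ^ ((k : ℝ) / (d * p)) / k := by positivity
  gcongr
  exact one_sub_mul_lt_rpow_neg (by positivity) ‹_› hc'

theorem radialMinorant_le {k d : ℕ} (hk : k ≠ 0) (hd : d ≠ 0) {p m c : ℝ} (hp : 0 < p) (hm : 0 < m)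
    (hc : 0 < c) :
    radialMinorant k d p m c ≤ (c ^ (-(1 / (d : ℝ)))) ^ k / k := by
  by_cases h : m * |c| ^ p = 1
  · rw [pow_div_eq_rpow hk hd hp hm hc, radialMinorant, h]
    simp
  · exact (radialMinorant_lt hk hd hp hm hc h).le

theorem ofReal_pow_div_le_volumeIoiPow {k : ℕ} (hk : k ≠ 0) {R : ℝ} (hR : 0 < R)
    {s : Set (Set.Ioi (0 : ℝ))} (hs : ∀ r : Set.Ioi (0 : ℝ), r.1 < R → r ∈ s) :
    ENNReal.ofReal (R ^ k / k) ≤ Measure.volumeIoiPow (k - 1) s := by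
  obtain ⟨j, rfl⟩ := Nat.exists_eq_succ_of_ne_zero hk
  refine le_trans (le_of_eq ?_) (measure_mono (s := Set.Iio (⟨R, hR⟩ : Set.Ioi (0 : ℝ)))
    fun r (hr : r < ⟨R, hR⟩) => hs r hr)
  rw [Measure.volumeIoiPow_apply_Iio]
  simp

theorem volumeIoiPow_univ {k : ℕ} (hk : k ≠ 0) :
    Measure.volumeIoiPow (k - 1) Set.univ = ⊤ := by
  refine ENNReal.eq_top_of_forall_nnreal_le fun a => ?_
  refine le_trans ?_ (ofReal_pow_div_le_volumeIoiPow hk (R := k * (a + 1)) (by positivity)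
    (fun _ _ => Set.mem_univ _))
  rw [← ENNReal.ofReal_coe_nnreal]
  refine ENNReal.ofReal_le_ofReal ?_
  have h1 : (1 : ℝ) ≤ k * (a + 1) := by
    have : (1 : ℝ) ≤ k := by exact_mod_cast Nat.one_le_iff_ne_zero.2 hk
    nlinarith [a.2]
  rw [le_div_iff₀ (by positivity)]
  nlinarith [le_self_pow₀ h1 hk, (k.cast_nonneg : (0 : ℝ) ≤ k)]

theorem volumeIoiPow_radial_eq_top {k d : ℕ} (hk : k ≠ 0) {c : ℝ} (hc : c ≤ 0) :
    Measure.volumeIoiPow (k - 1) {r | r.1 ^ d * c ≤ 1} = ⊤ := by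
  rw [← volumeIoiPow_univ hk]
  congr 1
  ext r
  have : 0 < r.1 ^ d := pow_pos r.2 d
  simp only [Set.mem_ofPred_eq, Set.mem_univ, iff_true]
  nlinarith

theorem ofReal_le_volumeIoiPow_radial {k d : ℕ} (hk : k ≠ 0) (hd : d ≠ 0) {c : ℝ} (hc : 0 < c) :
    ENNReal.ofReal ((c ^ (-(1 / (d : ℝ)))) ^ k / k)
      ≤ Measure.volumeIoiPow (k - 1) {r | r.1 ^ d * c ≤ 1} := by
  refine ofReal_pow_div_le_volumeIoiPow hk (by positivity) fun r hr => ?_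
  have h1 : r.1 ^ d ≤ (c ^ (-(1 / (d : ℝ)))) ^ d := pow_le_pow_left₀ r.2.le hr.le d
  have h2 : (c ^ (-(1 / (d : ℝ)))) ^ d = c⁻¹ := by
    rw [← Real.rpow_natCast, ← Real.rpow_mul hc.le, ← Real.rpow_neg_one]
    congr 1
    field_simp
  rw [h2] at h1
  calc r.1 ^ d * c ≤ c⁻¹ * c := by gcongr
    _ = 1 := inv_mul_cancel₀ hc.ne'

theorem radialMinorant_le_volumeIoiPow {k d : ℕ} (hk : k ≠ 0) (hd : d ≠ 0) {p m : ℝ} (hp : 0 < p)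
    (hm : 0 < m) (c : ℝ) :
    ENNReal.ofReal (radialMinorant k d p m c)
      ≤ Measure.volumeIoiPow (k - 1) {r | r.1 ^ d * c ≤ 1} := by
  rcases le_or_gt c 0 with hc | hc
  · simp [volumeIoiPow_radial_eq_top hk hc]
  · exact (ENNReal.ofReal_le_ofReal (radialMinorant_le hk hd hp hm hc)).trans
      (ofReal_le_volumeIoiPow_radial hk hd hc)

theorem eq_of_radialMinorant_eq_volumeIoiPow {k d : ℕ} (hk : k ≠ 0) (hd : d ≠ 0) {p m : ℝ}
    (hp : 0 < p) (hm : 0 < m) {c : ℝ} (h : ENNReal.ofReal (radialMinorant k d p m c)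
      = Measure.volumeIoiPow (k - 1) {r | r.1 ^ d * c ≤ 1}) :
    c = m ^ (-(1 / p)) := by
  rcases le_or_gt c 0 with hc | hc
  · simp [volumeIoiPow_radial_eq_top hk hc] at h
  · have h1 : m * |c| ^ p = 1 := by
      by_contra hne
      exact absurd h (ne_of_lt <| ((ENNReal.ofReal_lt_ofReal_iff (by positivity)).2
        (radialMinorant_lt hk hd hp hm hc hne)).trans_le (ofReal_le_volumeIoiPow_radial hk hd hc))
    rw [abs_of_pos hc] at h1
    rw [Real.rpow_neg hm.le, ← Real.inv_rpow hm.le, ← eq_inv_of_mul_eq_one_right h1,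
      ← Real.rpow_mul hc.le, mul_one_div_cancel hp.ne', Real.rpow_one]

/-- Among continuous functions that are homogeneous of degree `d` and lie in the unit ball of
`L^p` of the unit sphere, the volume of the sublevel set is smallest, with the value attained by
those constant on the sphere, and any minimizer is constant on the sphere. -/
theorem measure_sublevel_homogeneous {E : Type*} [NormedAddCommGroup E] [NormedSpace ℝ E]
    [MeasurableSpace E] [BorelSpace E] [FiniteDimensional ℝ E] [Nontrivial E]
    (μ : Measure E) [μ.IsAddHaarMeasure] {d : ℕ} (hd : d ≠ 0) {p : ℝ} (hp : 0 < p) {F : E → ℝ}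
    (hF : Continuous F) (hhom : ∀ (r : ℝ) (x : E), F (r • x) = r ^ d * F x)
    (hnorm : ∫ θ : Metric.sphere (0 : E) 1, |F θ| ^ p ∂μ.toSphere ≤ 1) :
    ENNReal.ofReal (μ.toSphere.real Set.univ ^ ((Module.finrank ℝ E : ℝ) / (d * p))
        * (μ.toSphere.real Set.univ / Module.finrank ℝ E)) ≤ μ {x | F x ≤ 1} ∧
      (μ {x | F x ≤ 1} = ENNReal.ofReal
          (μ.toSphere.real Set.univ ^ ((Module.finrank ℝ E : ℝ) / (d * p))
            * (μ.toSphere.real Set.univ / Module.finrank ℝ E)) →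
        ∀ θ : Metric.sphere (0 : E) 1, F θ = μ.toSphere.real Set.univ ^ (-(1 / p))) := by
  set k := Module.finrank ℝ E with hkdef
  set m := μ.toSphere.real Set.univ with hmdef
  have hk : k ≠ 0 := Module.finrank_pos.ne'
  have hm : 0 < m := by
    rw [hmdef, measureReal_def, ENNReal.toReal_pos_iff]
    exact ⟨Measure.measure_univ_pos.2 μ.toSphere_ne_zero, measure_lt_top _ _⟩
  have hint : Integrable (fun θ : Metric.sphere (0 : E) 1 => |F θ| ^ p) μ.toSphere := by
    have hc : Continuous fun θ : Metric.sphere (0 : E) 1 => |F θ| ^ p :=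
      (hF.comp continuous_subtype_val).abs.rpow_const fun _ => Or.inr hp.le
    exact hc.integrable_of_hasCompactSupport (HasCompactSupport.of_compactSpace _)
  have hint₁ : Integrable (fun θ : Metric.sphere (0 : E) 1 => m * |F θ| ^ p - 1) μ.toSphere :=
    (hint.const_mul m).sub (integrable_const _)
  have hint' : Integrable (fun θ : Metric.sphere (0 : E) 1 => radialMinorant k d p m (F θ))
      μ.toSphere :=
    ((integrable_const _).sub (hint₁.const_mul _)).const_mul _
  have hval : m ^ ((k : ℝ) / (d * p)) * (m / k)
      ≤ ∫ θ : Metric.sphere (0 : E) 1, radialMinorant k d p m (F θ) ∂μ.toSphere := by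
    simp only [radialMinorant]
    rw [integral_const_mul, integral_sub (integrable_const _) (hint₁.const_mul _),
      integral_const_mul,
      integral_sub (hint.const_mul m) (integrable_const _), integral_const_mul]
    simp only [integral_const, smul_eq_mul, mul_one, ← hmdef]
    have h1 : m * (∫ θ : Metric.sphere (0 : E) 1, |F θ| ^ p ∂μ.toSphere) - m ≤ 0 := by
      nlinarith
    have h2 : 0 ≤ (k : ℝ) / (d * p) := by positivity
    calc m ^ ((k : ℝ) / (d * p)) * (m / k) = m ^ ((k : ℝ) / (d * p)) / k * m := by ring
      _ ≤ _ := by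
        gcongr
        nlinarith
  have hvol : μ {x | F x ≤ 1} = ∫⁻ θ : Metric.sphere (0 : E) 1,
      Measure.volumeIoiPow (k - 1) {r | r.1 ^ d * F θ ≤ 1} ∂μ.toSphere := by
    rw [measure_eq_lintegral_toSphere μ (measurableSet_le hF.measurable measurable_const)]
    simp only [Set.mem_ofPred_eq, hhom, hkdef]
  have hle1 := (ENNReal.ofReal_le_ofReal hval).trans (ofReal_integral_le_lintegral_ofReal hint')
  have hle2 : ∀ θ : Metric.sphere (0 : E) 1, ENNReal.ofReal (radialMinorant k d p m (F θ))
      ≤ Measure.volumeIoiPow (k - 1) {r | r.1 ^ d * F θ ≤ 1} :=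
    fun θ => radialMinorant_le_volumeIoiPow hk hd hp hm (F θ)
  refine ⟨hvol ▸ hle1.trans (lintegral_mono hle2), fun heq => ?_⟩
  have hmeas : Measurable fun θ : Metric.sphere (0 : E) 1 =>
      Measure.volumeIoiPow (k - 1) {r | r.1 ^ d * F θ ≤ 1} := by
    have hT : MeasurableSet {q : Metric.sphere (0 : E) 1 × Set.Ioi (0 : ℝ) |
        q.2.1 ^ d * F q.1 ≤ 1} := by
      refine measurableSet_le (Continuous.measurable ?_) measurable_const
      fun_prop
    exact measurable_measure_prodMk_left hT
  have hae := ae_eq_of_ae_le_of_lintegral_le (μ := μ.toSphere) (.of_forall hle2)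
    (ne_top_of_le_ne_top ENNReal.ofReal_ne_top
      ((lintegral_mono hle2).trans (hvol ▸ heq).le)) hmeas.aemeasurable
    ((hvol ▸ heq).le.trans hle1)
  have hae' : (fun θ : Metric.sphere (0 : E) 1 => F θ) =ᵐ[μ.toSphere]
      fun _ => m ^ (-(1 / p)) := by
    filter_upwards [hae] with θ hθ
    exact eq_of_radialMinorant_eq_volumeIoiPow hk hd hp hm hθ
  exact congrFun ((hF.comp continuous_subtype_val).ae_eq_iff_eq μ.toSphere continuous_const |>.1
    hae')

theorem unitBallVol_eq {n : ℕ} (hn : 1 ≤ n) :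
    unitBallVol n = 2 * π ^ ((n : ℝ) / 2) / Real.Gamma ((n : ℝ) / 2) / n := by
  have h : (0 : ℝ) < n := by exact_mod_cast hn
  rw [unitBallVol, Real.Gamma_add_one (by positivity)]
  have := (Real.Gamma_pos_of_pos (half_pos h)).ne'
  field_simp

theorem volume_closedBall_eq_unitBallVol {n : ℕ} (hn : 1 ≤ n) {r : ℝ} (hr : 0 ≤ r) :
    volume (Metric.closedBall (0 : EuclideanSpace ℝ (Fin n)) r)
      = ENNReal.ofReal (r ^ n * unitBallVol n) := by
  have : Nonempty (Fin n) := ⟨⟨0, hn⟩⟩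
  rw [EuclideanSpace.volume_closedBall, ENNReal.ofReal_mul (by positivity), ENNReal.ofReal_pow hr,
    unitBallVol, Real.rpow_div_two_eq_sqrt _ Real.pi_nonneg, Real.rpow_natCast, Fintype.card_fin]

theorem toSphere_real_univ {n : ℕ} (hn : 1 ≤ n) :
    (volume : Measure (EuclideanSpace ℝ (Fin n))).toSphere.real Set.univ
      = 2 * π ^ ((n : ℝ) / 2) / Real.Gamma ((n : ℝ) / 2) := by
  have h : (0 : ℝ) < n := by exact_mod_cast hn
  have hpos : 0 ≤ unitBallVol n := by
    have := Real.Gamma_pos_of_pos (show (0 : ℝ) < (n : ℝ) / 2 + 1 by positivity)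
    unfold unitBallVol
    positivity
  have : Nonempty (Fin n) := ⟨⟨0, hn⟩⟩
  rw [Measure.toSphere_real_apply_univ, measureReal_def, ← Measure.addHaar_closedBall_eq_addHaar_ball,
    volume_closedBall_eq_unitBallVol hn zero_le_one, one_pow, one_mul, ENNReal.toReal_ofReal hpos,
    unitBallVol_eq hn, finrank_euclideanSpace_fin]
  field_simp

theorem eval_ballForm {n d : ℕ} (hd : Even d) (x : EuclideanSpace ℝ (Fin n)) :
    eval (fun i => x i) (ballForm n d) = ‖x‖ ^ d := by
  obtain ⟨e, rfl⟩ := hd.two_dvd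
  simp [ballForm, pow_mul, EuclideanSpace.real_norm_sq_eq]

theorem sublevelVol_eq (n : ℕ) (f : MvPolynomial (Fin n) ℝ) :
    sublevelVol n f = volume {x : EuclideanSpace ℝ (Fin n) | eval (fun i => x i) f ≤ 1} := by
  have hm : MeasurableSet {x : Fin n → ℝ | eval x f ≤ 1} :=
    measurableSet_le (MvPolynomial.continuous_eval f).measurable measurable_const
  exact ((PiLp.volume_preserving_ofLp (Fin n)).measure_preimage hm.nullMeasurableSet).symm

theorem sphereLpNorm_ballForm {n d : ℕ} (hn : 1 ≤ n) (hd : Even d) (p : ℝ) :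
    sphereLpNorm n p (ballForm n d)
      = (2 * π ^ ((n : ℝ) / 2) / Real.Gamma ((n : ℝ) / 2)) ^ (1 / p) := by
  have h : ∀ x : Metric.sphere (0 : EuclideanSpace ℝ (Fin n)) 1,
      |eval (fun i => (x : EuclideanSpace ℝ (Fin n)) i) (ballForm n d)| ^ p = 1 := fun x => by
    simp [eval_ballForm hd]
  rw [sphereLpNorm, ← toSphere_real_univ hn]
  simp only [h, integral_const, smul_eq_mul, mul_one]

theorem sublevelVol_smul_ballForm {n d : ℕ} (hn : 1 ≤ n) (hd0 : d ≠ 0) (hd : Even d) {c : ℝ}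
    (hc : 0 < c) :
    sublevelVol n (c⁻¹ • ballForm n d) = ENNReal.ofReal (c ^ ((n : ℝ) / d) * unitBallVol n) := by
  have hr : 0 ≤ c ^ (1 / (d : ℝ)) := by positivity
  have hrd : (c ^ (1 / (d : ℝ))) ^ d = c := by
    rw [one_div, Real.rpow_inv_natCast_pow hc.le hd0]
  have hset : {x : EuclideanSpace ℝ (Fin n) | eval (fun i => x i) (c⁻¹ • ballForm n d) ≤ 1}
      = Metric.closedBall 0 (c ^ (1 / (d : ℝ))) := by
    ext x
    rw [Set.mem_ofPred_eq, MvPolynomial.smul_eval, eval_ballForm hd, mem_closedBall_zero_iff,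
      inv_mul_le_iff₀ hc, mul_one, ← pow_le_pow_iff_left₀ (norm_nonneg x) hr hd0, hrd]
  rw [sublevelVol_eq, hset, volume_closedBall_eq_unitBallVol hn hr, ← Real.rpow_natCast,
    ← Real.rpow_mul hc.le, one_div_mul_eq_div]

theorem eval_smul_of_isHomogeneous {n d : ℕ} {f : MvPolynomial (Fin n) ℝ} (hf : f.IsHomogeneous d)
    (r : ℝ) (x : EuclideanSpace ℝ (Fin n)) :
    eval (fun i => (r • x) i) f = r ^ d * eval (fun i => x i) f := by
  rw [MvPolynomial.eval_eq', MvPolynomial.eval_eq', Finset.mul_sum]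
  refine Finset.sum_congr rfl fun e he => ?_
  have hdeg : ∑ i, e i = d := by
    rw [← hf (MvPolynomial.mem_support_iff.1 he), Pi.one_def, ← Finsupp.degree_eq_weight_one,
      Finsupp.degree_eq_sum]
  simp only [PiLp.smul_apply, smul_eq_mul, mul_pow, Finset.prod_mul_distrib,
    Finset.prod_pow_eq_pow_sum, hdeg]
  ring

/-- Every form `f` of even degree `d` with `‖f‖_{L^p(S^{n-1})} ≤ 1` satisfies
`v(f) ≥ (2π^{n/2}/Γ(n/2))^{n/(dp)} · π^{n/2}/Γ(n/2+1)`, with equality iff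
`f = b_{d,n}/‖b_{d,n}‖_{L^p(S^{n-1})}`, and `‖b_{d,n}‖_{L^p(S^{n-1})} = (2π^{n/2}/Γ(n/2))^{1/p}`. -/
theorem stmt3 (n d : ℕ) (hn : 1 ≤ n) (hd : 2 ≤ d) (hdeven : Even d) (p : ℝ) (hp : 1 ≤ p) :
    sphereLpNorm n p (ballForm n d)
        = (2 * π ^ ((n : ℝ) / 2) / Real.Gamma ((n : ℝ) / 2)) ^ (1 / p) ∧
    ∀ f : MvPolynomial (Fin n) ℝ, f.IsHomogeneous d → sphereLpNorm n p f ≤ 1 →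
      ENNReal.ofReal
          ((2 * π ^ ((n : ℝ) / 2) / Real.Gamma ((n : ℝ) / 2)) ^ ((n : ℝ) / (d * p))
            * unitBallVol n)
        ≤ sublevelVol n f ∧
      (sublevelVol n f
          = ENNReal.ofReal
              ((2 * π ^ ((n : ℝ) / 2) / Real.Gamma ((n : ℝ) / 2)) ^ ((n : ℝ) / (d * p))
                * unitBallVol n) ↔
        f = (sphereLpNorm n p (ballForm n d))⁻¹ • ballForm n d) := by
  have hm : 0 < 2 * π ^ ((n : ℝ) / 2) / Real.Gamma ((n : ℝ) / 2) := by
    have h : (0 : ℝ) < n := by exact_mod_cast hn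
    have := Real.Gamma_pos_of_pos (half_pos h)
    positivity
  have hp0 : 0 < p := one_pos.trans_le hp
  have hd0 : d ≠ 0 := by omega
  rw [sphereLpNorm_ballForm hn hdeven p]
  refine ⟨rfl, fun f hf hnorm => ?_⟩
  have : Nonempty (Fin n) := ⟨⟨0, hn⟩⟩
  have hcont : Continuous fun x : EuclideanSpace ℝ (Fin n) => eval (fun i => x i) f :=
    (MvPolynomial.continuous_eval f).comp (by fun_prop)
  have hint : ∫ θ : Metric.sphere (0 : EuclideanSpace ℝ (Fin n)) 1,
      |eval (fun i => (θ : EuclideanSpace ℝ (Fin n)) i) f| ^ p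
      ∂(volume : Measure (EuclideanSpace ℝ (Fin n))).toSphere ≤ 1 := by
    have h0 : 0 ≤ ∫ θ : Metric.sphere (0 : EuclideanSpace ℝ (Fin n)) 1,
        |eval (fun i => (θ : EuclideanSpace ℝ (Fin n)) i) f| ^ p
        ∂(volume : Measure (EuclideanSpace ℝ (Fin n))).toSphere :=
      integral_nonneg fun θ => by positivity
    by_contra! hlt
    exact absurd hnorm (not_le.2 (Real.one_lt_rpow hlt (by positivity)))
  have key := measure_sublevel_homogeneous volume hd0 hp0 hcont (eval_smul_of_isHomogeneous hf) hint
  rw [toSphere_real_univ hn, finrank_euclideanSpace_fin, ← unitBallVol_eq hn,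
    ← sublevelVol_eq] at key
  refine ⟨key.1, fun heq => ?_, ?_⟩
  · have hs := key.2 heq
    refine MvPolynomial.funext fun x => ?_
    rw [MvPolynomial.smul_eval, ← Real.rpow_neg hm.le]
    have hx := eval_ballForm hdeven (WithLp.toLp 2 x)
    rw [show (fun i => (WithLp.toLp 2 x) i) = x from rfl] at hx
    rw [hx]
    have hsph : ∀ y : EuclideanSpace ℝ (Fin n), eval (fun i => y i) f = ‖y‖ ^ d *
        (2 * π ^ ((n : ℝ) / 2) / Real.Gamma ((n : ℝ) / 2)) ^ (-(1 / p)) := by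
      intro y
      rcases eq_or_ne y 0 with rfl | hy
      · have := eval_smul_of_isHomogeneous hf 0 0
        simpa [hd0] using this
      · have hy' : ‖y‖ ≠ 0 := norm_ne_zero_iff.2 hy
        rw [← hs ⟨‖y‖⁻¹ • y, by simp [norm_smul, hy']⟩, ← eval_smul_of_isHomogeneous hf]
        simp [smul_smul, hy']
    rw [mul_comm]
    exact hsph (WithLp.toLp 2 x)
  · rintro rfl
    rw [sublevelVol_smul_ballForm hn hd0 hdeven (by positivity), ← Real.rpow_mul hm.le]
    congr 3
    field_simp
end

section
/- Let n ≥ 1, let d ≥ 2 be even, and let f be a real form of degree d in n variables such that the sublevel set {x ∈ ℝⁿ : f(x) ≤ 1} has finite Lebesgue volume. Then vol{x ∈ ℝⁿ : f(x) ≤ 1} = (1/Γ(1+n/d)) · ∫_{ℝⁿ} exp(−f(x)) dx. -/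
open MvPolynomial MeasureTheory Real Finset

/-- Evaluating a form of degree `d` at a rescaled point multiplies the value by `r ^ d`. -/
theorem MvPolynomial.IsHomogeneous.eval_smul_point {σ R : Type*} [Fintype σ] [CommSemiring R]
    {f : MvPolynomial σ R} {d : ℕ} (hf : f.IsHomogeneous d) (r : R) (x : σ → R) :
    eval (r • x) f = r ^ d * eval x f := by
  rw [eval_eq', eval_eq', Finset.mul_sum]
  refine Finset.sum_congr rfl fun m hm ↦ ?_
  have hdeg : ∑ i, m i = d := by
    rw [← Finsupp.degree_eq_sum, Finsupp.degree_eq_weight_one]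
    exact hf (mem_support_iff.mp hm)
  simp only [Pi.smul_apply, smul_eq_mul, mul_pow, Finset.prod_mul_distrib,
    Finset.prod_pow_eq_pow_sum, hdeg]
  ring

/-- The tail integral of `t ↦ exp (-t)` as a lower Lebesgue integral. -/
theorem lintegral_exp_neg_Ioi (c : ℝ) :
    ∫⁻ t in Set.Ioi c, ENNReal.ofReal (exp (-t)) = ENNReal.ofReal (exp (-c)) := by
  rw [← ofReal_integral_eq_lintegral_ofReal (integrableOn_exp_neg_Ioi c)
    (ae_of_all _ fun t ↦ (exp_pos _).le), integral_exp_neg_Ioi]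

/-- Euler's integral for the Gamma function as a lower Lebesgue integral. -/
theorem lintegral_exp_neg_mul_rpow {a : ℝ} (ha : 0 ≤ a) :
    ∫⁻ t in Set.Ioi 0, ENNReal.ofReal (exp (-t)) * ENNReal.ofReal (t ^ a)
      = ENNReal.ofReal (Gamma (1 + a)) := by
  have ha' : 0 < 1 + a := by linarith
  have hint := GammaIntegral_convergent ha'
  rw [Gamma_eq_integral ha', ofReal_integral_eq_lintegral_ofReal hint]
  · refine lintegral_congr fun t ↦ ?_
    rw [← ENNReal.ofReal_mul (exp_pos _).le, add_sub_cancel_left]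
  · filter_upwards [ae_restrict_mem measurableSet_Ioi] with t ht
    exact mul_nonneg (exp_pos _).le (rpow_nonneg (le_of_lt ht) _)

/-- If the sublevel sets of an almost everywhere nonnegative function `g` have measures
`t ^ a * V`, then the integral of `exp (-g)` equals `V * Γ(1 + a)`. -/
theorem lintegral_exp_neg_of_measure_le {α : Type*} [MeasurableSpace α] (μ : Measure α)
    [SFinite μ] {g : α → ℝ} (hg : Measurable g) (hpos : ∀ᵐ x ∂μ, 0 ≤ g x) {a : ℝ} (ha : 0 ≤ a)
    (V : ENNReal) (hV : ∀ t, 0 < t → μ {x | g x ≤ t} = ENNReal.ofReal (t ^ a) * V) :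
    ∫⁻ x, ENNReal.ofReal (exp (-g x)) ∂μ = ENNReal.ofReal (Gamma (1 + a)) * V := by
  have hmeas : MeasurableSet {p : α × ℝ | g p.1 ≤ p.2} :=
    measurableSet_le (hg.comp measurable_fst) measurable_snd
  have hexp : Measurable fun t : ℝ ↦ ENNReal.ofReal (exp (-t)) := by fun_prop
  let F : α → ℝ → ENNReal := fun x t ↦
    {p : α × ℝ | g p.1 ≤ p.2}.indicator (fun p ↦ ENNReal.ofReal (exp (-p.2))) (x, t)
  have hF : Measurable (Function.uncurry F) := (hexp.comp measurable_snd).indicator hmeas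
  have hx : ∀ᵐ x ∂μ, ENNReal.ofReal (exp (-g x)) = ∫⁻ t in Set.Ioi 0, F x t := by
    filter_upwards [hpos] with x hx
    have h1 : ∫⁻ t in Set.Ioi 0, F x t = ∫⁻ t in Set.Ici 0, F x t :=
      setLIntegral_congr Ioi_ae_eq_Ici
    have h2 : F x = (Set.Ici (g x)).indicator fun t ↦ ENNReal.ofReal (exp (-t)) := by
      ext t
      simp [F, Set.indicator]
    rw [h1, h2, setLIntegral_indicator measurableSet_Ici, Set.Ici_inter_Ici, sup_of_le_left hx,
      ← lintegral_exp_neg_Ioi]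
    exact setLIntegral_congr Ioi_ae_eq_Ici
  have ht : ∀ t ∈ Set.Ioi (0 : ℝ), ∫⁻ x, F x t ∂μ
      = ENNReal.ofReal (exp (-t)) * ENNReal.ofReal (t ^ a) * V := by
    intro t ht
    have h : (fun x ↦ F x t) = {x | g x ≤ t}.indicator fun _ ↦ ENNReal.ofReal (exp (-t)) := by
      ext x
      simp [F, Set.indicator]
    rw [h, lintegral_indicator_const (measurableSet_le hg measurable_const), hV t ht, mul_assoc]
  rw [lintegral_congr_ae hx, lintegral_lintegral_swap hF.aemeasurable,
    setLIntegral_congr_fun measurableSet_Ioi ht, lintegral_mul_const _ (by fun_prop),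
    lintegral_exp_neg_mul_rpow ha]

/-- Rescaling the sublevel sets of a form of degree `d` in `n` variables. -/
theorem MvPolynomial.IsHomogeneous.volume_sublevel {n d : ℕ} (hd : d ≠ 0)
    {f : MvPolynomial (Fin n) ℝ} (hf : f.IsHomogeneous d) {t : ℝ} (ht : 0 < t) :
    volume {x : Fin n → ℝ | eval x f ≤ t}
      = ENNReal.ofReal (t ^ ((n : ℝ) / d)) * volume {x : Fin n → ℝ | eval x f ≤ 1} := by
  have hs : 0 < t ^ (-(1 / (d : ℝ))) := rpow_pos_of_pos ht _
  have hd' : (d : ℝ) ≠ 0 := Nat.cast_ne_zero.mpr hd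
  have hpow : (t ^ (-(1 / (d : ℝ)))) ^ d = t⁻¹ := by
    rw [← rpow_mul_natCast ht.le, ← rpow_neg_one]
    congr 1
    field_simp
  have hpre : {x : Fin n → ℝ | eval x f ≤ t}
      = (t ^ (-(1 / (d : ℝ))) • ·) ⁻¹' {x : Fin n → ℝ | eval x f ≤ 1} := by
    ext x
    simp only [Set.mem_ofPred_eq, Set.mem_preimage, hf.eval_smul_point, hpow]
    rw [inv_mul_le_iff₀ ht, mul_one]
  rw [hpre, Measure.addHaar_preimage_smul _ hs.ne', Module.finrank_fin_fun,
    abs_of_pos (by positivity), ← rpow_mul_natCast ht.le, ← rpow_neg ht.le]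
  congr 3
  ring

/-- A form in at least one variable whose sublevel set has finite volume is almost everywhere
positive. -/
theorem MvPolynomial.IsHomogeneous.ae_pos {n d : ℕ} (hn : n ≠ 0)
    {f : MvPolynomial (Fin n) ℝ} (hf : f.IsHomogeneous d)
    (hvol : volume {x : Fin n → ℝ | eval x f ≤ 1} < ⊤) :
    ∀ᵐ x : Fin n → ℝ, 0 < eval x f := by
  simp only [ae_iff, not_lt]
  set N := {x : Fin n → ℝ | eval x f ≤ 0} with hN
  have hfin : volume N ≠ ⊤ :=
    ((measure_mono fun x (hx : eval x f ≤ 0) ↦ hx.trans zero_le_one).trans_lt hvol).ne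
  have hpre : ((2 : ℝ) • ·) ⁻¹' N = N := by
    ext x
    simp only [hN, Set.mem_ofPred_eq, Set.mem_preimage, hf.eval_smul_point]
    exact mul_nonpos_iff_pos_imp_nonpos.trans (by simp)
  have h := Measure.addHaar_preimage_smul volume (two_ne_zero' ℝ) N
  rw [hpre, Module.finrank_fin_fun, abs_of_pos (by positivity)] at h
  have h' := congrArg ENNReal.toReal h
  rw [ENNReal.toReal_mul, ENNReal.toReal_ofReal (by positivity)] at h'
  have hlt : ((2 : ℝ) ^ n)⁻¹ < 1 := inv_lt_one_of_one_lt₀ (one_lt_pow₀ one_lt_two hn)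
  have h0 : (volume N).toReal = 0 := by
    by_contra hne
    exact hlt.ne' (mul_right_cancel₀ hne (by rw [one_mul]; exact h'))
  exact (ENNReal.toReal_eq_zero_iff _).mp h0 |>.resolve_right hfin

/-- If the sublevel set `{x ∈ ℝⁿ : f(x) ≤ 1}` of a form `f` of even degree `d` has finite
Lebesgue volume, then `vol{f ≤ 1} = (1/Γ(1+n/d)) ∫_{ℝⁿ} exp(-f(x)) dx`. -/
theorem stmt17 (n d : ℕ) (hn : 1 ≤ n) (hd : 2 ≤ d) (hdeven : Even d)
    (f : MvPolynomial (Fin n) ℝ) (hf : f.IsHomogeneous d)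
    (hvol : volume {x : Fin n → ℝ | eval x f ≤ 1} < ⊤) :
    (volume {x : Fin n → ℝ | eval x f ≤ 1}).toReal
      = (1 / Real.Gamma (1 + (n : ℝ) / d)) * ∫ x : Fin n → ℝ, Real.exp (-(eval x f)) := by
  have hcont : Continuous fun x : Fin n → ℝ ↦ eval x f := MvPolynomial.continuous_eval f
  have hΓ : 0 < Gamma (1 + (n : ℝ) / d) := Gamma_pos_of_pos (by positivity)
  have hmeas : AEStronglyMeasurable (fun x : Fin n → ℝ ↦ exp (-(eval x f))) volume :=
    hcont.neg.rexp.aestronglyMeasurable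
  rw [integral_eq_lintegral_of_nonneg_ae (ae_of_all _ fun x ↦ (exp_pos _).le) hmeas,
    lintegral_exp_neg_of_measure_le volume hcont.measurable
      ((hf.ae_pos (by omega) hvol).mono fun x hx ↦ hx.le) (by positivity) _
      fun t ht ↦ hf.volume_sublevel (by omega) ht,
    ENNReal.toReal_mul, ENNReal.toReal_ofReal hΓ.le]
  field_simp
end
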